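/- Let op_0 op_1 ... op_n be a valid sequence of order-2 stack operations. Then for all 0 ≤ j ≤ n, push1(j) = −1 if and only if for all 0 ≤ k ≤ j the factor op_k ... op_j does not belong to L1. -/

import Mathlib

/-- Order-2 stack operations over stack alphabet `S`. -/
inductive Op (S : Type) : Type where
  | push1 : S → Op S
  | pop1  : Op S
  | push2 : Op S
  | pop2  : Op S
  | collapse : Op S
  deriving DecidableEq

/-- Annotated stack symbol: (symbol, collapse link, position annotation). -/
abbrev ASym (S : Type) : Type := S × ℕ × ℤ
/-- Annotated order-1 stack, topmost symbol first. -/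
abbrev Stk1 (S : Type) : Type := List (ASym S)
/-- Annotated order-2 stack: list of (position annotation, order-1 stack), topmost first.
In `[[u_1][u_2] ⋯ [u_n]]` the topmost stack `u_n` comes first in the list. -/
abbrev Stk2 (S : Type) : Type := List (ℤ × Stk1 S)

/-- The initial order-2 stack `[[]]`, its unique (empty) order-1 stack annotated `-1`. -/
def initStk (S : Type) : Stk2 S := [(-1, ([] : Stk1 S))]

/-- One step of the annotated semantics; `p` is the current position.
`push1 s` records the collapse link `n-1` (number of stacks below the top) and the
position annotation `p`; `push2` duplicates the top stack annotating the copy with `p`;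
`collapse` keeps the bottom `i` order-1 stacks, where `i` is the collapse link of the
topmost symbol.  Undefined operations yield `none`. -/
def step {S : Type} (p : ℕ) (op : Op S) (W : Stk2 S) : Option (Stk2 S) :=
  match op, W with
  | .push2, t :: rest => some (((p : ℤ), t.2) :: t :: rest)
  | .pop2, _ :: t :: rest => some (t :: rest)
  | .push1 s, (a, u) :: rest => some ((a, (s, rest.length, (p : ℤ)) :: u) :: rest)
  | .pop1, (a, _ :: u) :: rest => some ((a, u) :: rest)
  | .collapse, (_, (_, i, _) :: _) :: _ =>
      if 1 ≤ i ∧ i < W.length then some (W.drop (W.length - i)) else none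
  | _, _ => none

def runFrom {S : Type} (p : ℕ) (W : Stk2 S) : List (Op S) → Option (Stk2 S)
  | [] => some W
  | op :: rest => (step p op W).bind fun W' => runFrom (p + 1) W' rest

/-- `stkAt ops j` is the annotated order-2 stack `W_j` after executing `op_0 ⋯ op_j`
(for `j = -1` this is the initial stack `[[]]`). -/
def stkAt {S : Type} (ops : List (Op S)) (j : ℤ) : Option (Stk2 S) :=
  runFrom 0 (initStk S) (ops.take (j + 1).toNat)

/-- A nonempty sequence of operations is valid if every operation is defined,
starting from the empty order-2 stack `[[]]`. -/
def Valid {S : Type} (ops : List (Op S)) : Prop :=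
  ops ≠ [] ∧ (runFrom 0 (initStk S) ops).isSome

/-- `push1At ops j` is `push1(j)`: the position annotation of the topmost symbol of the
topmost order-1 stack of `W_j`, or `-1` if that stack is empty (also `-1` for `j = -1`). -/
def push1At {S : Type} (ops : List (Op S)) (j : ℤ) : ℤ :=
  match stkAt ops j with
  | some ((_, (_, _, p) :: _) :: _) => p
  | _ => -1

/-- `Push2At ops j` is `Push2(j)`: the position annotation of the topmost order-1 stack
of `W_j` (`-1` for `j = -1`). -/
def Push2At {S : Type} (ops : List (Op S)) (j : ℤ) : ℤ :=
  match stkAt ops j with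
  | some ((a, _) :: _) => a
  | _ => -1

mutual
/-- Words derived from the nonterminal `S1` of the grammar
`S1 → ↑1 | S1 ↑2 | S1 S1 ↓1 | S1 S2 ↓2 | S1 S2 S1 ⇓`
(all letters `↑1(s)` are identified with the single letter `↑1`). -/
inductive InL1 {S : Type} : List (Op S) → Prop where
  | base (s : S) : InL1 [Op.push1 s]
  | push2 (w : List (Op S)) : InL1 w → InL1 (w ++ [Op.push2])
  | pop1 (v w : List (Op S)) : InL1 v → InL1 w → InL1 (v ++ w ++ [Op.pop1])
  | pop2 (v w : List (Op S)) : InL1 v → InL2 w → InL1 (v ++ w ++ [Op.pop2])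
  | collapse (v w x : List (Op S)) : InL1 v → InL2 w → InL1 x →
      InL1 (v ++ w ++ x ++ [Op.collapse])

/-- Words derived from the nonterminal `S2` of the grammar
`S2 → ↑2 | S2 ↑1 | S2 ↓1 | S2 S2 ↓2 | S2 S2 S1 ⇓`. -/
inductive InL2 {S : Type} : List (Op S) → Prop where
  | base : InL2 [Op.push2]
  | push1 (s : S) (w : List (Op S)) : InL2 w → InL2 (w ++ [Op.push1 s])
  | pop1 (w : List (Op S)) : InL2 w → InL2 (w ++ [Op.pop1])
  | pop2 (v w : List (Op S)) : InL2 v → InL2 w → InL2 (v ++ w ++ [Op.pop2])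
  | collapse (v w x : List (Op S)) : InL2 v → InL2 w → InL1 x →
      InL2 (v ++ w ++ x ++ [Op.collapse])
end

/-- The factor `op_i ⋯ op_j` of the sequence. -/
def factor {S : Type} (ops : List (Op S)) (i j : ℕ) : List (Op S) :=
  (ops.drop i).take (j + 1 - i)

/-- Run from the initial stack. -/
def runI {S : Type} (l : List (Op S)) : Option (Stk2 S) := runFrom 0 (initStk S) l

theorem runFrom_append {S : Type} (l l' : List (Op S)) : ∀ (p : ℕ) (W : Stk2 S),
    runFrom p W (l ++ l') = (runFrom p W l).bind fun W' => runFrom (p + l.length) W' l' := by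
  induction l with
  | nil => intro p W; simp [runFrom]
  | cons op l ih =>
    intro p W
    simp only [List.cons_append, runFrom, Option.bind_assoc, List.length_cons]
    congr 1
    funext W'
    rw [ih]
    congr 1
    funext W''
    congr 1
    omega

theorem runI_snoc {S : Type} (l : List (Op S)) (op : Op S) :
    runI (l ++ [op]) = (runI l).bind fun W => step l.length op W := by
  simp [runI, runFrom_append, runFrom]

theorem runI_append_some {S : Type} {l l' : List (Op S)} {W : Stk2 S}
    (h : runI (l ++ l') = some W) : ∃ W', runI l = some W' := by
  unfold runI at h ⊢
  rw [runFrom_append] at h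
  cases h' : runFrom 0 (initStk S) l with
  | none => simp [h'] at h
  | some W' => exact ⟨W', rfl⟩

theorem runI_snoc_some {S : Type} {l : List (Op S)} {op : Op S} {W : Stk2 S}
    (h : runI (l ++ [op]) = some W) : ∃ W', runI l = some W' ∧ step l.length op W' = some W := by
  rw [runI_snoc] at h
  simpa [Option.bind_eq_some_iff] using h

/-- The structural invariant of annotated stacks. -/
def Good {S : Type} (pre : List (Op S)) (W : Stk2 S) : Prop :=
  ∀ a u rest, (a, u) :: rest <:+ W →
    ((rest = [] ∧ a = -1) ∨
      ∃ m, m ++ [Op.push2] <+: pre ∧ a = (m.length : ℤ) ∧ runI m = some rest) ∧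
    ∀ s i p u', (s, i, p) :: u' <:+ u → ∃ m a' rest', m ++ [Op.push1 s] <+: pre ∧
      p = (m.length : ℤ) ∧ runI m = some ((a', u') :: rest') ∧ i = rest'.length ∧ rest' <:+ rest

theorem Good.mono {S : Type} {pre pre' : List (Op S)} {W W' : Stk2 S} (h : Good pre W)
    (hp : pre <+: pre') (hW : W' <:+ W) : Good pre' W' := by
  intro a u rest hs
  obtain ⟨h1, h2⟩ := h a u rest (hs.trans hW)
  refine ⟨?_, ?_⟩
  · rcases h1 with h1 | ⟨m, hm, h1⟩
    · exact Or.inl h1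
    · exact Or.inr ⟨m, hm.trans hp, h1⟩
  · intro s i p u' hu
    obtain ⟨m, a', rest', hm, h3⟩ := h2 s i p u' hu
    exact ⟨m, a', rest', hm.trans hp, h3⟩

/-- Inversion of a step. -/
theorem step_push2 {S : Type} {n : ℕ} {W W' : Stk2 S} (h : step n Op.push2 W = some W') :
    ∃ a u rest, W = (a, u) :: rest ∧ W' = ((n : ℤ), u) :: (a, u) :: rest := by
  rcases W with _ | ⟨⟨a, u⟩, rest⟩
  · simp [step] at h
  · simp only [step, Option.some.injEq] at h
    exact ⟨a, u, rest, rfl, h.symm⟩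

theorem step_pop2 {S : Type} {n : ℕ} {W W' : Stk2 S} (h : step n Op.pop2 W = some W') :
    ∃ a u, W = (a, u) :: W' ∧ W' ≠ [] := by
  rcases W with _ | ⟨⟨a, u⟩, _ | ⟨t, rest⟩⟩
  · simp [step] at h
  · simp [step] at h
  · simp only [step, Option.some.injEq] at h
    subst h
    exact ⟨a, u, rfl, by simp⟩

theorem step_push1 {S : Type} {n : ℕ} {s : S} {W W' : Stk2 S}
    (h : step n (Op.push1 s) W = some W') :
    ∃ a u rest, W = (a, u) :: rest ∧ W' = (a, (s, rest.length, (n : ℤ)) :: u) :: rest := by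
  rcases W with _ | ⟨⟨a, u⟩, rest⟩
  · simp [step] at h
  · simp only [step, Option.some.injEq] at h
    exact ⟨a, u, rest, rfl, h.symm⟩

theorem step_pop1 {S : Type} {n : ℕ} {W W' : Stk2 S} (h : step n Op.pop1 W = some W') :
    ∃ a s i p u rest, W = (a, (s, i, p) :: u) :: rest ∧ W' = (a, u) :: rest := by
  rcases W with _ | ⟨⟨a, _ | ⟨⟨s, i, p⟩, u⟩⟩, rest⟩
  · simp [step] at h
  · simp [step] at h
  · simp only [step, Option.some.injEq] at h
    exact ⟨a, s, i, p, u, rest, rfl, h.symm⟩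

theorem step_collapse {S : Type} {n : ℕ} {W W' : Stk2 S} (h : step n Op.collapse W = some W') :
    ∃ a s i p u rest, W = (a, (s, i, p) :: u) :: rest ∧ W' <:+ W ∧ W'.length = i ∧ 1 ≤ i := by
  rcases W with _ | ⟨⟨a, _ | ⟨⟨s, i, p⟩, u⟩⟩, rest⟩
  · simp [step] at h
  · simp [step] at h
  · simp only [step] at h
    split_ifs at h with hc
    simp only [Option.some.injEq] at h
    refine ⟨a, s, i, p, u, rest, rfl, ?_, ?_, hc.1⟩
    · rw [← h]; exact List.drop_suffix _ _
    · rw [← h, List.length_drop]; omega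

theorem good_run {S : Type} (pre : List (Op S)) : ∀ W, runI pre = some W → Good pre W := by
  induction pre using List.reverseRecOn with
  | nil =>
    intro W h
    simp only [runI, runFrom, initStk, Option.some.injEq] at h
    subst h
    intro a u rest hs
    have := hs.length_le
    simp only [List.length_cons, List.length_nil] at this
    have hr : rest = [] := List.length_eq_zero_iff.mp (by omega)
    subst hr
    have := hs.eq_of_length rfl
    simp only [List.cons.injEq, Prod.mk.injEq, and_true] at this
    obtain ⟨rfl, rfl⟩ := this
    exact ⟨Or.inl ⟨rfl, rfl⟩, fun s i p u' hu => by simp at hu⟩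
  | append_singleton pre op ih =>
    intro W h
    obtain ⟨W0, h0, hs⟩ := runI_snoc_some h
    have g := ih W0 h0
    have hp : pre <+: pre ++ [op] := List.prefix_append _ _
    cases op with
    | push2 =>
      obtain ⟨a, u, rest, rfl, rfl⟩ := step_push2 hs
      intro b v r hsf
      rcases List.suffix_cons_iff.mp hsf with he | hsf
      · simp only [List.cons.injEq, Prod.mk.injEq] at he
        obtain ⟨⟨rfl, rfl⟩, rfl⟩ := he
        refine ⟨Or.inr ⟨pre, List.prefix_refl _, rfl, h0⟩, ?_⟩
        intro s i p u' hu
        obtain ⟨m, a', rest', hm, h1, h2, h3, h4⟩ := (g a v rest (List.suffix_refl _)).2 s i p u' hu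
        exact ⟨m, a', rest', hm.trans hp, h1, h2, h3, h4.trans (List.suffix_cons _ _)⟩
      · exact (g.mono hp (List.suffix_refl _)) b v r hsf
    | pop2 =>
      obtain ⟨a, u, rfl, -⟩ := step_pop2 hs
      exact g.mono hp (List.suffix_cons _ _)
    | push1 s =>
      obtain ⟨a, u, rest, rfl, rfl⟩ := step_push1 hs
      have g' := g.mono hp (List.suffix_refl _)
      intro b v r hsf
      rcases List.suffix_cons_iff.mp hsf with he | hsf
      · simp only [List.cons.injEq, Prod.mk.injEq] at he
        obtain ⟨⟨rfl, rfl⟩, rfl⟩ := he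
        refine ⟨(g' b u r (List.suffix_refl _)).1, ?_⟩
        intro s' i p u' hu
        rcases List.suffix_cons_iff.mp hu with he | hu
        · simp only [List.cons.injEq, Prod.mk.injEq] at he
          obtain ⟨⟨rfl, rfl, rfl⟩, rfl⟩ := he
          exact ⟨pre, b, r, List.prefix_refl _, rfl, h0, rfl, List.suffix_refl _⟩
        · exact (g' b u r (List.suffix_refl _)).2 s' i p u' hu
      · exact g' b v r (hsf.trans (List.suffix_cons _ _))
    | pop1 =>
      obtain ⟨a, s, i, p, u, rest, rfl, rfl⟩ := step_pop1 hs
      have g' := g.mono hp (List.suffix_refl _)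
      intro b v r hsf
      rcases List.suffix_cons_iff.mp hsf with he | hsf
      · simp only [List.cons.injEq, Prod.mk.injEq] at he
        obtain ⟨⟨rfl, rfl⟩, rfl⟩ := he
        obtain ⟨h1, h2⟩ := g' b _ r (List.suffix_refl _)
        exact ⟨h1, fun s i p u' hu => h2 s i p u' (hu.trans (List.suffix_cons _ _))⟩
      · exact g' b v r (hsf.trans (List.suffix_cons _ _))
    | collapse =>
      obtain ⟨a, s, i, p, u, rest, rfl, hsf, -, -⟩ := step_collapse hs
      exact g.mono hp hsf

theorem prefix_eq_left {S : Type} {m a b : List (Op S)} {op : Op S} (h : m ++ [op] <+: a ++ b)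
    (hl : (a.length : ℤ) = (m.length : ℤ)) : m = a := by
  have h1 : m <+: a ++ b := (List.prefix_append _ _).trans h
  have h2 : a <+: a ++ b := List.prefix_append _ _
  exact (List.prefix_of_prefix_length_le h1 h2 (by omega)).eq_of_length (by omega)

/-- Using the invariant for the top symbol. -/
theorem top_sym {S : Type} {m x : List (Op S)} {a s i p u rest}
    (h : runI (m ++ x) = some ((a, (s, i, p) :: u) :: rest)) (hp : p = (m.length : ℤ)) :
    ∃ a' rest', runI m = some ((a', u) :: rest') ∧ i = rest'.length ∧ rest' <:+ rest ∧
      m.length < (m ++ x).length := by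
  obtain ⟨m', a', rest', h1, h2, h3, h4, h5⟩ :=
    (good_run _ _ h a _ rest (List.suffix_refl _)).2 s i p u (List.suffix_refl _)
  obtain rfl := prefix_eq_left h1 (by omega)
  have := h1.length_le
  simp only [List.length_append, List.length_singleton] at this
  exact ⟨a', rest', h3, h4, h5, by simp only [List.length_append]; omega⟩

/-- Using the invariant for the top stack. -/
theorem top_stk {S : Type} {m x : List (Op S)} {a u rest}
    (h : runI (m ++ x) = some ((a, u) :: rest)) (hp : a = (m.length : ℤ)) :
    runI m = some rest ∧ m.length < (m ++ x).length := by
  rcases (good_run _ _ h a u rest (List.suffix_refl _)).1 with ⟨-, h1⟩ | ⟨m', h1, h2, h3⟩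
  · omega
  · obtain rfl := prefix_eq_left h1 (by omega)
    have := h1.length_le
    simp only [List.length_append, List.length_singleton] at this
    exact ⟨h3, by simp only [List.length_append]; omega⟩

/-- Collapse undoes everything since the creation of the stack in which the symbol was pushed. -/
theorem stk_collapse_eq {S : Type} {n : ℕ} {m x : List (Op S)} {W W' : Stk2 S}
    (h : runI (m ++ x) = some W) (hs : step n Op.collapse W = some W')
    (ht : ∀ a s i p u rest, W = (a, (s, i, p) :: u) :: rest → p = (m.length : ℤ)) :
    ∃ a u, runI m = some ((a, u) :: W') ∧ W' ≠ [] ∧ m.length < (m ++ x).length := by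
  obtain ⟨a, s, i, p, u, rest, rfl, hsf, hl, h1⟩ := step_collapse hs
  obtain ⟨a', rest', h2, h3, h4, h5⟩ := top_sym h (ht _ _ _ _ _ _ rfl)
  have : W' = rest' := by
    have h6 := h4.trans (List.suffix_cons (a, (s, i, p) :: u) rest)
    exact (List.suffix_of_suffix_length_le hsf h6 (by omega)).eq_of_length (by omega)
  subst this
  exact ⟨a', u, h2, by rintro rfl; simp at hl; omega, h5⟩

/-- Topmost symbol annotation equals `n`. -/
def Top1 {S : Type} (W : Stk2 S) (n : ℕ) : Prop :=
  ∃ a s i u rest, W = (a, (s, i, (n : ℤ)) :: u) :: rest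

/-- Topmost stack annotation equals `n`. -/
def Top2 {S : Type} (W : Stk2 S) (n : ℕ) : Prop :=
  ∃ u rest, W = ((n : ℤ), u) :: rest

mutual
theorem sound1 {S : Type} {w : List (Op S)} (hw : InL1 w) (pre : List (Op S)) (W : Stk2 S)
    (h : runI (pre ++ w) = some W) : Top1 W pre.length := by
  match hw with
  | .base s =>
    obtain ⟨W0, h0, hs⟩ := runI_snoc_some h
    obtain ⟨a, u, rest, rfl, rfl⟩ := step_push1 hs
    exact ⟨_, _, _, _, _, rfl⟩
  | .push2 w hw =>
    rw [← List.append_assoc] at h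
    obtain ⟨W0, h0, hs⟩ := runI_snoc_some h
    obtain ⟨a, s, i, u, rest, rfl⟩ := sound1 hw pre W0 h0
    obtain ⟨a, u, rest, he, rfl⟩ := step_push2 hs
    simp only [List.cons.injEq, Prod.mk.injEq] at he
    obtain ⟨⟨rfl, rfl⟩, rfl⟩ := he
    exact ⟨_, _, _, _, _, rfl⟩
  | .pop1 v w hv hw =>
    simp only [← List.append_assoc] at h
    obtain ⟨W2, h2, hs⟩ := runI_snoc_some h
    obtain ⟨W1, h1⟩ := runI_append_some h2
    obtain ⟨a, s, i, u, rest, rfl⟩ := sound1 hw (pre ++ v) W2 h2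
    obtain ⟨a1, s1, i1, u1, rest1, rfl⟩ := sound1 hv pre W1 h1
    obtain ⟨a', rest', h3, -⟩ := top_sym h2 rfl
    rw [h1] at h3
    simp only [Option.some.injEq, List.cons.injEq, Prod.mk.injEq] at h3
    obtain ⟨⟨rfl, rfl⟩, rfl⟩ := h3
    simp only [step, Option.some.injEq] at hs
    exact ⟨_, _, _, _, _, hs.symm⟩
  | .pop2 v w hv hw =>
    simp only [← List.append_assoc] at h
    obtain ⟨W2, h2, hs⟩ := runI_snoc_some h
    obtain ⟨W1, h1⟩ := runI_append_some h2
    obtain ⟨a, u, rfl, -⟩ := step_pop2 hs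
    obtain ⟨u', rest, he⟩ := sound2 hw (pre ++ v) _ h2
    simp only [List.cons.injEq, Prod.mk.injEq] at he
    have h3 := (top_stk h2 he.1.1).1
    exact sound1 hv pre W h3
  | .collapse v w x hv hw hx =>
    simp only [← List.append_assoc] at h
    obtain ⟨W3, h3, hs⟩ := runI_snoc_some h
    obtain ⟨a, s, i, u, rest, hW⟩ := sound1 hx (pre ++ v ++ w) _ h3
    obtain ⟨a', u', h4, -⟩ := stk_collapse_eq h3 hs (by
      intro a' s' i' p' u' rest' he
      rw [hW] at he
      simp only [List.cons.injEq, Prod.mk.injEq] at he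
      exact he.1.2.1.2.2.symm)
    obtain ⟨u', rest, he⟩ := sound2 hw (pre ++ v) _ h4
    simp only [List.cons.injEq, Prod.mk.injEq] at he
    exact sound1 hv pre W (top_stk h4 he.1.1).1

theorem sound2 {S : Type} {w : List (Op S)} (hw : InL2 w) (pre : List (Op S)) (W : Stk2 S)
    (h : runI (pre ++ w) = some W) : Top2 W pre.length := by
  match hw with
  | .base =>
    obtain ⟨W0, h0, hs⟩ := runI_snoc_some h
    obtain ⟨a, u, rest, rfl, rfl⟩ := step_push2 hs
    exact ⟨_, _, rfl⟩
  | .push1 s w hw =>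
    rw [← List.append_assoc] at h
    obtain ⟨W0, h0, hs⟩ := runI_snoc_some h
    obtain ⟨a, u, rest, rfl, rfl⟩ := step_push1 hs
    obtain ⟨u, rest, he⟩ := sound2 hw pre _ h0
    simp only [List.cons.injEq, Prod.mk.injEq] at he
    exact ⟨_, _, by rw [he.1.1]⟩
  | .pop1 w hw =>
    rw [← List.append_assoc] at h
    obtain ⟨W0, h0, hs⟩ := runI_snoc_some h
    obtain ⟨a, s, i, p, u, rest, rfl, rfl⟩ := step_pop1 hs
    obtain ⟨u, rest, he⟩ := sound2 hw pre _ h0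
    simp only [List.cons.injEq, Prod.mk.injEq] at he
    exact ⟨_, _, by rw [he.1.1]⟩
  | .pop2 v w hv hw =>
    simp only [← List.append_assoc] at h
    obtain ⟨W2, h2, hs⟩ := runI_snoc_some h
    obtain ⟨a, u, rfl, -⟩ := step_pop2 hs
    obtain ⟨u', rest, he⟩ := sound2 hw (pre ++ v) _ h2
    simp only [List.cons.injEq, Prod.mk.injEq] at he
    exact sound2 hv pre W (top_stk h2 he.1.1).1
  | .collapse v w x hv hw hx =>
    simp only [← List.append_assoc] at h
    obtain ⟨W3, h3, hs⟩ := runI_snoc_some h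
    obtain ⟨a, s, i, u, rest, hW⟩ := sound1 hx (pre ++ v ++ w) _ h3
    obtain ⟨a', u', h4, -⟩ := stk_collapse_eq h3 hs (by
      intro a' s' i' p' u' rest' he
      rw [hW] at he
      simp only [List.cons.injEq, Prod.mk.injEq] at he
      exact he.1.2.1.2.2.symm)
    obtain ⟨u', rest, he⟩ := sound2 hw (pre ++ v) _ h4
    simp only [List.cons.injEq, Prod.mk.injEq] at he
    exact sound2 hv pre W (top_stk h4 he.1.1).1
end

theorem complete {S : Type} (n : ℕ) : ∀ (pre : List (Op S)) (W : Stk2 S), pre.length = n →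
    runI pre = some W →
    (∀ a s i p u rest, W = (a, (s, i, p) :: u) :: rest →
      ∃ m w, pre = m ++ w ∧ p = (m.length : ℤ) ∧ InL1 w) ∧
    (∀ a u rest, W = (a, u) :: rest → rest ≠ [] →
      ∃ m w, pre = m ++ w ∧ a = (m.length : ℤ) ∧ InL2 w) := by
  induction n using Nat.strong_induction_on with
  | _ n ih =>
  intro pre W hn h
  rcases List.eq_nil_or_concat pre with rfl | ⟨q, op, rfl⟩
  · simp only [runI, runFrom, initStk, Option.some.injEq] at h
    subst h
    constructor
    · intro a s i p u rest he; simp at he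
    · intro a u rest he hr; simp at he; exact absurd he.2 hr
  · rw [List.concat_eq_append] at h hn ⊢
    obtain ⟨W0, h0, hs⟩ := runI_snoc_some h
    simp only [List.length_append, List.length_singleton] at hn
    obtain ⟨c1, c2⟩ := ih q.length (by omega) q W0 rfl h0
    cases op with
    | push2 =>
      obtain ⟨a, u, rest, rfl, rfl⟩ := step_push2 hs
      constructor
      · intro b s i p v r he
        simp only [List.cons.injEq, Prod.mk.injEq] at he
        obtain ⟨⟨rfl, rfl⟩, rfl⟩ := he
        obtain ⟨m, w, rfl, hp, hw⟩ := c1 _ _ _ _ _ _ rfl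
        exact ⟨m, w ++ [Op.push2], by simp, hp, .push2 w hw⟩
      · intro b v r he _
        simp only [List.cons.injEq, Prod.mk.injEq] at he
        exact ⟨q, [Op.push2], rfl, he.1.1.symm, .base⟩
    | push1 s =>
      obtain ⟨a, u, rest, rfl, rfl⟩ := step_push1 hs
      constructor
      · intro b s' i p v r he
        simp only [List.cons.injEq, Prod.mk.injEq] at he
        exact ⟨q, [Op.push1 s], rfl, he.1.2.1.2.2.symm, .base s⟩
      · intro b v r he hr
        simp only [List.cons.injEq, Prod.mk.injEq] at he
        obtain ⟨⟨rfl, rfl⟩, rfl⟩ := he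
        obtain ⟨m, w, rfl, hp, hw⟩ := c2 _ _ _ rfl hr
        exact ⟨m, w ++ [Op.push1 s], by simp, hp, .push1 s w hw⟩
    | pop1 =>
      obtain ⟨a, s, i, p, u, rest, rfl, rfl⟩ := step_pop1 hs
      constructor
      · intro b s' i' p' v r he
        simp only [List.cons.injEq, Prod.mk.injEq] at he
        obtain ⟨⟨rfl, rfl⟩, rfl⟩ := he
        obtain ⟨m, w, rfl, hp, hw⟩ := c1 _ _ _ _ _ _ rfl
        obtain ⟨a', rest', h3, -, -, hl⟩ := top_sym h0 hp
        obtain ⟨m', v', rfl, hp', hv'⟩ := (ih m.length (by omega) m _ rfl h3).1 _ _ _ _ _ _ rfl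
        exact ⟨m', v' ++ w ++ [Op.pop1], by simp, hp', .pop1 v' w hv' hw⟩
      · intro b v r he hr
        simp only [List.cons.injEq, Prod.mk.injEq] at he
        obtain ⟨⟨rfl, rfl⟩, rfl⟩ := he
        obtain ⟨m, w, rfl, hp, hw⟩ := c2 _ _ _ rfl hr
        exact ⟨m, w ++ [Op.pop1], by simp, hp, .pop1 w hw⟩
    | pop2 =>
      obtain ⟨a, u, rfl, hne⟩ := step_pop2 hs
      obtain ⟨m, w, rfl, hp, hw⟩ := c2 _ _ _ rfl hne
      obtain ⟨h3, hl⟩ := top_stk h0 hp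
      obtain ⟨d1, d2⟩ := ih m.length (by omega) m _ rfl h3
      constructor
      · intro b s' i' p' v r he
        obtain ⟨m', v', rfl, hp', hv'⟩ := d1 _ _ _ _ _ _ he
        exact ⟨m', v' ++ w ++ [Op.pop2], by simp, hp', .pop2 v' w hv' hw⟩
      · intro b v r he hr
        obtain ⟨m', v', rfl, hp', hv'⟩ := d2 _ _ _ he hr
        exact ⟨m', v' ++ w ++ [Op.pop2], by simp, hp', .pop2 v' w hv' hw⟩
    | collapse =>
      obtain ⟨a, s, i, p, u, rest, hW0, -⟩ := step_collapse hs
      obtain ⟨k, x, rfl, hp, hx⟩ := c1 _ _ _ _ _ _ hW0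
      obtain ⟨a', u', h4, hne, hl⟩ := stk_collapse_eq h0 hs (by
        intro a' s' i' p' u' rest' he
        rw [hW0] at he
        simp only [List.cons.injEq, Prod.mk.injEq] at he
        exact he.1.2.1.2.2.symm.trans hp)
      obtain ⟨m, w, rfl, hp, hw⟩ := (ih k.length (by omega) k _ rfl h4).2 _ _ _ rfl hne
      obtain ⟨h3, hl'⟩ := top_stk h4 hp
      obtain ⟨d1, d2⟩ := ih m.length (by omega) m _ rfl h3
      constructor
      · intro b s' i' p' v r he
        obtain ⟨m', v', rfl, hp', hv'⟩ := d1 _ _ _ _ _ _ he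
        exact ⟨m', v' ++ w ++ x ++ [Op.collapse], by simp, hp', .collapse v' w x hv' hw hx⟩
      · intro b v r he hr
        obtain ⟨m', v', rfl, hp', hv'⟩ := d2 _ _ _ he hr
        exact ⟨m', v' ++ w ++ x ++ [Op.collapse], by simp, hp', .collapse v' w x hv' hw hx⟩

theorem InL1_ne_nil {S : Type} {w : List (Op S)} (h : InL1 w) : w ≠ [] := by
  cases h <;> simp

/-- For a valid sequence `op_0 ⋯ op_n` of order-2 stack operations and all
`0 ≤ j ≤ n`: `push1(j) = -1` iff no factor `op_k ⋯ op_j` (`0 ≤ k ≤ j`) belongs to `L1`. -/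
theorem push1_eq_neg_one_iff {S : Type} (ops : List (Op S)) (hv : Valid ops)
    (j : ℕ) (hj : j < ops.length) :
    push1At ops (j : ℤ) = -1 ↔ ∀ k : ℕ, k ≤ j → ¬ InL1 (factor ops k j) := by
  have hst : stkAt ops (j : ℤ) = runI (ops.take (j + 1)) := rfl
  obtain ⟨V, hV⟩ := Option.isSome_iff_exists.mp hv.2
  obtain ⟨W, hW⟩ : ∃ W, runI (ops.take (j + 1)) = some W := by
    apply runI_append_some (l' := ops.drop (j + 1)) (W := V)
    rw [List.take_append_drop]
    exact hV
  have key : ∀ k, k ≤ j → ops.take (j + 1) = ops.take k ++ factor ops k j := by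
    intro k hk
    have : j + 1 = k + (j + 1 - k) := by omega
    conv_lhs => rw [this]
    rw [List.take_add]
    rfl
  constructor
  · intro hm k hk hL
    have hW' := hW
    rw [key k hk] at hW'
    obtain ⟨a, s, i, u, rest, rfl⟩ := sound1 hL _ _ hW'
    simp only [push1At, hst, hW] at hm
    omega
  · intro hall
    simp only [push1At, hst, hW]
    rcases W with _ | ⟨⟨a, _ | ⟨⟨s, i, p⟩, u⟩⟩, rest⟩
    · rfl
    · rfl
    · exfalso
      obtain ⟨m, w, he, -, hw⟩ := (complete _ _ _ rfl hW).1 _ _ _ _ _ _ rfl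
      have hpos : 0 < w.length := List.length_pos_iff.mpr (InL1_ne_nil hw)
      have hlen := congrArg List.length he
      simp only [List.length_take, List.length_append] at hlen
      have hk : m.length ≤ j := by omega
      apply hall m.length hk
      have h2 := key _ hk
      rw [he] at h2
      have := (List.append_inj h2 (by simp; omega)).2
      rw [← this]
      exact hw
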